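/- arXiv:2603.13953 — 3 statements merged into one kernel-verified Lean document; each statement's English description precedes it below -/
import Mathlib

section
/- Let k ≥ 2 be an integer, let i, j ∈ {0,1,…,k−1}, and let ℓ be an integer with max(0, i+j+2−k) ≤ ℓ, ℓ ≤ i and ℓ ≤ j. Then the number of permutations π of {1,…,k} with N_π(i,j) = ℓ, π(i+1) ≥ j+2, and π⁻¹(j+1) ≥ i+2 equals i!·j!·(k−i−1)!·(k−j−1)! / ((i−ℓ)!·(j−ℓ)!·(k+ℓ−i−j−2)!·ℓ!). -/
open Nat Finset

/-- `Nperm k π i j` is the number of `m ∈ {1,…,k}` with `m ≤ i` and `π(m) ≤ j`,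
where the permutation `π` of `{1,…,k}` is represented 0-indexed on `Fin k`. -/
def Nperm (k : ℕ) (π : Equiv.Perm (Fin k)) (i j : ℕ) : ℕ :=
  (Finset.univ.filter fun m : Fin k => (m : ℕ) < i ∧ ((π m : ℕ) < j)).card

lemma card_comp_eq {α ι : Type*} [Fintype α] [DecidableEq α] [Fintype ι] [DecidableEq ι]
    (f c : α → ι) (h : ∀ x, (univ.filter fun a => c a = x).card = (univ.filter fun a => f a = x).card) :
    (univ.filter fun π : Equiv.Perm α => f ∘ π = c).card
      = ∏ x, ((univ.filter fun a => f a = x).card)! := by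
  have e : ∀ x, Nonempty ({a // c a = x} ≃ {a // f a = x}) := fun x =>
    ⟨Fintype.equivOfCardEq (by rw [Fintype.card_subtype, Fintype.card_subtype]; exact h x)⟩
  let e' := fun x => Classical.choice (e x)
  let σ : Equiv.Perm α := Equiv.ofFiberEquiv e'
  have hσ : ∀ a, f (σ a) = c a := fun a => Equiv.ofFiberEquiv_map e' a
  have := DomMulAct.stabilizer_card (f := f)
  simp only [Fintype.card_subtype] at this
  rw [← this]
  refine Finset.card_bij' (fun π _ => σ.symm.trans π) (fun π _ => σ.trans π) ?_ ?_ ?_ ?_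
  · intro π hπ
    simp only [mem_filter, mem_univ, true_and] at hπ ⊢
    funext a
    have := congrFun hπ (σ.symm a)
    simp only [Function.comp, Equiv.trans_apply] at this ⊢
    rw [this, ← hσ]; simp
  · intro π hπ
    simp only [mem_filter, mem_univ, true_and] at hπ ⊢
    funext a
    have := congrFun hπ (σ a)
    simp only [Function.comp, Equiv.trans_apply] at this ⊢
    rw [this, ← hσ]
  · intro π _; ext; simp
  · intro π _; ext; simp

/-- The colour of a column. -/
def colr (k : ℕ) (j : Fin k) (m : Fin k) : Fin 3 :=
  if m < j then 0 else if m = j then 1 else 2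

/-- The colouring of rows given by a set `S` and a point `p`. -/
def rowc (k : ℕ) (S : Finset (Fin k)) (p : Fin k) (m : Fin k) : Fin 3 :=
  if m ∈ S then 0 else if m = p then 1 else 2

lemma colr_eq (k : ℕ) (j : Fin k) : colr k j = rowc k (Iio j) j := by
  funext m; simp [colr, rowc]

lemma rowc_card (k : ℕ) (S : Finset (Fin k)) (p : Fin k) (hp : p ∉ S) (x : Fin 3) :
    (univ.filter fun a => rowc k S p a = x).card =
      if x = 0 then S.card else if x = 1 then 1 else k - S.card - 1 := by
  fin_cases x
  · simp only [Fin.zero_eta, if_true]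
    congr 1; ext m; simp [rowc]; split_ifs <;> simp_all
  · simp only [Fin.mk_one, if_true, one_ne_zero, if_false]
    rw [Finset.card_eq_one]
    refine ⟨p, ?_⟩
    ext m; simp [rowc]; grind
  · have : (univ.filter fun a => rowc k S p a = 2) = (insert p S)ᶜ := by
      ext m; simp [rowc]; grind
    simp [this, card_compl, hp]

lemma fiber_card (k : ℕ) (j : Fin k) (S : Finset (Fin k)) (p : Fin k) (hp : p ∉ S)
    (hS : S.card = j) :
    (univ.filter fun π : Equiv.Perm (Fin k) => colr k j ∘ π = rowc k S p).card =
      (j : ℕ)! * (k - j - 1)! := by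
  have hj : j ∉ Iio j := by simp
  rw [colr_eq, card_comp_eq]
  · simp only [rowc_card k _ _ hj, Fin.prod_univ_three]
    simp
  · intro x
    rw [rowc_card k _ _ hj, rowc_card k _ _ hp]
    simp [hS]

lemma count_nat (k ℓ : ℕ) (i j : Fin k) (hℓ3 : ℓ ≤ j) :
    (Finset.univ.filter fun π : Equiv.Perm (Fin k) =>
        Nperm k π i j = ℓ ∧ ((j:ℕ) + 1 ≤ (π i : ℕ)) ∧ ((i:ℕ) + 1 ≤ (π.symm j : ℕ))).card =
      ((i:ℕ).choose ℓ * ((k - i - 1).choose (j - ℓ) * (k - i - 1 - (j - ℓ)))) *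
        ((j : ℕ)! * (k - j - 1)!) := by
  let T : Finset (Finset (Fin k) × (Σ _ : Finset (Fin k), Fin k)) :=
    (powersetCard ℓ (Iio i)) ×ˢ ((powersetCard (j - ℓ) (Ioi i)).sigma fun S => Ioi i \ S)
  have hT : T.card = (i:ℕ).choose ℓ * ((k - i - 1).choose (j - ℓ) * (k - i - 1 - (j - ℓ))) := by
    simp only [T, card_product, card_powersetCard, card_sigma]
    rw [Finset.sum_congr rfl (g := fun _ => k - i - 1 - (j - ℓ))]
    · simp [Nat.sub_right_comm]
    · intro S hS
      rw [mem_powersetCard] at hS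
      rw [card_sdiff_of_subset hS.1, hS.2]; simp [Nat.sub_right_comm]
  let F : Equiv.Perm (Fin k) → Finset (Fin k) × (Σ _ : Finset (Fin k), Fin k) := fun π =>
    (univ.filter fun m => m < i ∧ π m < j, ⟨univ.filter fun m => i < m ∧ π m < j, π.symm j⟩)
  rw [Finset.card_eq_sum_card_fiberwise (f := F) (t := T)]
  · rw [Finset.sum_congr rfl (g := fun _ => (j : ℕ)! * (k - j - 1)!)]
    · simp [hT]
    · rintro ⟨S1, S2, p⟩ h
      simp only [T, mem_product, mem_powersetCard, mem_sigma, mem_sdiff, mem_Ioi] at h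
      obtain ⟨⟨h1, h1c⟩, ⟨h2, h2c⟩, hip, hp2⟩ := h
      have h1' : ∀ m ∈ S1, m < i := fun m hm => by simpa using h1 hm
      have h2' : ∀ m ∈ S2, i < m := fun m hm => by simpa using h2 hm
      have hp : p ∉ S1 ∪ S2 := by
        simp only [mem_union, not_or]
        exact ⟨fun h => absurd (h1' p h) (by simpa using hip.le), hp2⟩
      have hd : Disjoint S1 S2 := by
        rw [Finset.disjoint_left]; intro m ha hb
        exact absurd (h1' m ha) (by simpa using (h2' m hb).le)
      rw [← fiber_card k j (S1 ∪ S2) p hp (by rw [card_union_of_disjoint hd]; omega)]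
      congr 1
      ext π
      simp only [mem_filter, mem_univ, true_and, F, Prod.mk.injEq, Sigma.mk.injEq, heq_eq_eq]
      constructor
      · rintro ⟨⟨hN, hi, hj⟩, hS1, hS2, hpp⟩
        funext m
        subst hS1 hS2 hpp
        have hi' : j < π i := hi
        have hmi : m = i → ¬ (π m < j) := by rintro rfl; exact hi'.le.not_gt
        have hmp : m = π.symm j ↔ π m = j := Equiv.eq_symm_apply _
        simp only [Function.comp, colr, rowc, mem_union, mem_filter, mem_univ, true_and, hmp]
        have : ((m < i ∧ π m < j) ∨ (i < m ∧ π m < j)) ↔ π m < j := by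
          rcases lt_trichotomy m i with h | h | h
          · simp [h, h.le]
          · simp [h ▸ hmi h, h]
          · simp [h, h.le]
        simp only [this]
      · intro hc
        have hlt : ∀ m, π m < j ↔ m ∈ S1 ∪ S2 := by
          intro m
          have := congrFun hc m
          simp only [Function.comp, colr, rowc] at this
          grind
        have heq : ∀ m, m ∉ S1 ∪ S2 → (π m = j ↔ m = p) := by
          intro m hm
          have := congrFun hc m
          have h3 := hlt m
          simp only [Function.comp, colr, rowc] at this
          grind
        have hpj : π p = j := (heq p hp).2 rfl
        have hpj' : π.symm j = p := by rw [← hpj]; simp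
        have hS1 : (univ.filter fun m => m < i ∧ π m < j) = S1 := by
          ext m
          simp only [mem_filter, mem_univ, true_and, hlt, mem_union]
          have := h1' m
          have := h2' m
          grind
        have hS2 : (univ.filter fun m => i < m ∧ π m < j) = S2 := by
          ext m
          simp only [mem_filter, mem_univ, true_and, hlt, mem_union]
          have := h1' m
          have := h2' m
          grind
        refine ⟨⟨?_, ?_, ?_⟩, hS1, hS2, hpj'⟩
        · rw [← h1c, ← hS1]; rfl
        · have hi : i ∉ S1 ∪ S2 := by
            simp only [mem_union, not_or]
            exact ⟨fun h => absurd (h1' i h) (lt_irrefl _), fun h => absurd (h2' i h) (lt_irrefl _)⟩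
          have a1 := hlt i
          have a2 := heq i hi
          have : j < π i := by
            have : i ≠ p := hip.ne
            grind
          exact this
        · rw [hpj']; exact hip
  · intro π hπ
    simp only [coe_filter, mem_univ, true_and, Set.mem_ofPred_eq] at hπ
    obtain ⟨hN, hi, hj⟩ := hπ
    have hi' : j < π i := hi
    have hj' : i < π.symm j := hj
    simp only [T, F, mem_coe, mem_product, mem_powersetCard, mem_sigma, mem_sdiff, mem_Ioi]
    have hN' : (univ.filter fun m => m < i ∧ π m < j).card = ℓ := hN
    refine ⟨⟨?_, hN'⟩, ⟨?_, ?_⟩, hj', ?_⟩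
    · intro m; simp; tauto
    · intro m; simp; tauto
    · have hall : (univ.filter fun m => π m < j).card = j := by
        rw [← Fin.card_Iio j]
        refine Finset.card_equiv π ?_
        simp
      have hu : (univ.filter fun m => π m < j) =
          (univ.filter fun m => m < i ∧ π m < j) ∪ (univ.filter fun m => i < m ∧ π m < j) := by
        ext m
        simp only [mem_filter, mem_univ, true_and, mem_union]
        rcases lt_trichotomy m i with h | h | h
        · simp [h, h.le]
        · subst h; simp [hi'.le]
        · simp [h, h.le]
      rw [hu, card_union_of_disjoint, hN'] at hall
      · omega
      · rw [Finset.disjoint_left]; intro m; simp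
        intro a _ b; exact absurd a b.le.not_gt
    · simp

/-- Count of permutations `π` of `{1,…,k}` with `N_π(i,j) = ℓ`, `π(i+1) ≥ j+2` and
`π⁻¹(j+1) ≥ i+2` (0-indexed: `π(i) ≥ j+1` and `π⁻¹(j) ≥ i+1` on `Fin k`). -/
theorem stmt_9 (k i j ℓ : ℕ) (hk : 2 ≤ k) (hik : i < k) (hjk : j < k)
    (hℓ1 : i + j + 2 ≤ k + ℓ) (hℓ2 : ℓ ≤ i) (hℓ3 : ℓ ≤ j) :
    ((Finset.univ.filter fun π : Equiv.Perm (Fin k) =>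
        Nperm k π i j = ℓ ∧ (j + 1 ≤ (π ⟨i, hik⟩ : ℕ)) ∧ (i + 1 ≤ (π.symm ⟨j, hjk⟩ : ℕ))).card : ℝ) =
      ((i ! : ℝ) * (j !) * ((k - i - 1)!) * ((k - j - 1)!)) /
        (((i - ℓ)! : ℝ) * ((j - ℓ)!) * ((k + ℓ - i - j - 2)!) * (ℓ !)) := by
  have h := count_nat k ℓ ⟨i, hik⟩ ⟨j, hjk⟩ hℓ3
  simp only at h
  rw [h, eq_div_iff (by positivity)]
  have e1 := Nat.choose_mul_factorial_mul_factorial hℓ2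
  have e2 := Nat.choose_mul_factorial_mul_factorial (n := k - i - 1) (k := j - ℓ) (by omega)
  obtain ⟨r, hr⟩ : ∃ r, k - i - 1 - (j - ℓ) = r + 1 := ⟨k - i - 1 - (j - ℓ) - 1, by omega⟩
  have hr' : k + ℓ - i - j - 2 = r := by omega
  rw [hr, Nat.factorial_succ] at e2
  rw [hr, hr', ← e1, ← e2]
  push_cast
  ring
end

section
/- Let k ≥ 2 be an integer, let i, j ∈ {0,1,…,k}, and set u = i/k and v = j/k. Let the coefficient vector α = (α_π), indexed by the k! permutations π of {1,…,k}, be chosen uniformly at random with respect to Lebesgue measure from the standard simplex σ^{k!−1} = {α : α_π ≥ 0 for all π, Σ_π α_π = 1}, and set Y_k(u,v) = Σ_π α_π·C_π(u,v). Then the expected value of Y_k(u,v) equals uv, and the variance of Y_k(u,v) equals uv(1−u)(1−v)/((k!+1)(k−1)), i.e. V[Y_k(u,v)] = V[X_k(u,v)]/(k!+1) where X_k is the random discrete copula induced by a uniformly random permutation. -/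
open Nat Finset MeasureTheory

/-- The corner simplex `{x : x ≥ 0 componentwise, ∑ x ≤ 1}` in `ℝ^{S_k ∖ {id}}`,
parametrizing the standard simplex `σ^{k!−1}` (the remaining coordinate being
`1 − ∑ x`). -/
def cornerSimplex (k : ℕ) : Set ({π : Equiv.Perm (Fin k) // π ≠ 1} → ℝ) :=
  {x | (∀ q, 0 ≤ x q) ∧ ∑ q, x q ≤ 1}

/-- Normalized Lebesgue measure on the corner simplex: the uniform distribution on the
standard simplex `σ^{k!−1}` of coefficient vectors `(α_π)_{π ∈ S_k}`. -/
noncomputable def simplexUniform (k : ℕ) :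
    Measure ({π : Equiv.Perm (Fin k) // π ≠ 1} → ℝ) :=
  (volume (cornerSimplex k))⁻¹ • volume.restrict (cornerSimplex k)

/-- The coefficient `α_π` as a function of the corner-simplex point `x`:
`α_π = x_π` for `π ≠ id`, and `α_id = 1 − ∑ x`. -/
noncomputable def coeff (k : ℕ) (x : {π : Equiv.Perm (Fin k) // π ≠ 1} → ℝ)
    (π : Equiv.Perm (Fin k)) : ℝ :=
  if h : π = 1 then 1 - ∑ q, x q else x ⟨π, h⟩


lemma beta_nat (t : ℝ) (p q : ℕ) :
    ∫ x in (0:ℝ)..t, x ^ p * (t - x) ^ q = t ^ (p + q + 1) * ((p ! : ℝ) * q !) / ((p + q + 1)! : ℝ) := by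
  induction p generalizing q with
  | zero =>
    have h := intervalIntegral.integral_comp_sub_left (a := 0) (b := t) (fun x : ℝ => x ^ q) t
    simp only [pow_zero, one_mul]
    rw [h]
    simp only [sub_self, sub_zero, integral_pow, Nat.factorial_zero, zero_add, Nat.factorial_succ]
    have := Nat.factorial_ne_zero q
    push_cast
    have h2 : (q ! : ℝ) ≠ 0 := by positivity
    have h3 : (q : ℝ) + 1 ≠ 0 := by positivity
    rw [one_mul, div_eq_div_iff h3 (by positivity)]
    simp
    ring
  | succ p ih =>
    have hv : ∀ x ∈ Set.uIcc 0 t, HasDerivAt (fun x : ℝ => -(t - x) ^ (q + 1) / (q + 1)) ((t - x) ^ q) x := by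
      intro x _
      have h1 : HasDerivAt (fun x : ℝ => t - x) (-1) x := by
        simpa using (hasDerivAt_id x).const_sub t
      have h2 := ((h1.pow (q + 1)).neg).div_const ((q : ℝ) + 1)
      have : (q : ℝ) + 1 ≠ 0 := by positivity
      refine HasDerivAt.congr_deriv h2 ?_
      symm
      rw [eq_div_iff this]
      push_cast
      ring
    have hu : ∀ x ∈ Set.uIcc 0 t, HasDerivAt (fun x : ℝ => x ^ (p + 1)) ((p + 1 : ℝ) * x ^ p) x := by
      intro x _
      simpa using hasDerivAt_pow (p + 1) x
    rw [intervalIntegral.integral_mul_deriv_eq_deriv_mul hu hv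
      (Continuous.intervalIntegrable (by fun_prop) _ _)
      (Continuous.intervalIntegrable (by fun_prop) _ _)]
    have h3 : ∀ x : ℝ, (p + 1 : ℝ) * x ^ p * (-(t - x) ^ (q + 1) / (q + 1))
        = (-(p + 1 : ℝ) / (q + 1)) * (x ^ p * (t - x) ^ (q + 1)) := by
      intro x; ring
    simp only [h3]
    rw [intervalIntegral.integral_const_mul, ih]
    have e : p + (q + 1) + 1 = p + 1 + q + 1 := by ring
    rw [e, Nat.factorial_succ q, Nat.factorial_succ p]
    have : (q : ℝ) + 1 ≠ 0 := by positivity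
    have : ((p + 1 + q + 1)! : ℝ) ≠ 0 := by positivity
    push_cast
    field_simp
    simp

/-- corner simplex of size `t` -/
def simpT (ι : Type*) [Fintype ι] (t : ℝ) : Set (ι → ℝ) :=
  {x | (∀ q, 0 ≤ x q) ∧ ∑ q, x q ≤ t}

lemma simpT_compact (ι : Type*) [Fintype ι] (t : ℝ) : IsCompact (simpT ι t) := by
  apply IsCompact.of_isClosed_subset (isCompact_Icc (a := (0 : ι → ℝ)) (b := fun _ => t))
  · apply IsClosed.inter
    · have : {x : ι → ℝ | ∀ q, 0 ≤ x q} = ⋂ q, {x | 0 ≤ x q} := by ext; simp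
      show IsClosed {x : ι → ℝ | ∀ q, 0 ≤ x q}
      rw [this]
      exact isClosed_iInter fun q => isClosed_le (by fun_prop) (by fun_prop)
    · exact isClosed_le (f := fun x : ι → ℝ => ∑ q, x q) (by fun_prop) (by fun_prop)
  · rintro x ⟨h1, h2⟩
    refine ⟨fun q => h1 q, fun q => ?_⟩
    exact (Finset.single_le_sum (fun i _ => h1 i) (Finset.mem_univ q)).trans h2

lemma dirichlet_fin (n : ℕ) : ∀ (t : ℝ) (_ : 0 ≤ t) (p : Fin n → ℕ) (m : ℕ),
    ∫ x in simpT (Fin n) t, (∏ i, x i ^ p i) * (t - ∑ i, x i) ^ m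
      = t ^ (n + ∑ i, p i + m) * ((∏ i, ((p i)! : ℝ)) * m !) / ((n + ∑ i, p i + m)! : ℝ) := by
  induction n with
  | zero =>
    intro t ht p m
    have h0 : simpT (Fin 0) t = Set.univ := by
      ext x; simp [simpT, ht]
    have : (m ! : ℝ) ≠ 0 := by positivity
    rw [h0, Measure.restrict_univ, volume_pi, Measure.pi_of_empty, integral_dirac]
    simp
    field_simp
  | succ n ih =>
    intro t ht p m
    set f : (Fin (n+1) → ℝ) → ℝ := fun x => (∏ i, x i ^ p i) * (t - ∑ i, x i) ^ m with hf
    have hfc : Continuous f := by fun_prop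
    have hS := simpT_compact (Fin (n+1)) t
    have hint : Integrable ((simpT (Fin (n+1)) t).indicator f) := by
      rw [integrable_indicator_iff hS.measurableSet]
      exact hfc.continuousOn.integrableOn_compact hS
    have mp := (volume_preserving_piFinSuccAbove (fun _ : Fin (n + 1) => ℝ) 0).symm
    rw [← integral_indicator hS.measurableSet, ← mp.integral_comp' (g := (simpT (Fin (n+1)) t).indicator f)]
    have hint2 := (mp.integrable_comp_emb (MeasurableEquiv.measurableEmbedding _)).2 hint
    rw [Measure.volume_eq_prod] at hint2 ⊢
    erw [integral_prod _ hint2]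
    simp only [Function.comp_apply]
    have key : ∀ a : ℝ, ∫ y : Fin n → ℝ, (simpT (Fin (n+1)) t).indicator f
        ((MeasurableEquiv.piFinSuccAbove (fun _ : Fin (n + 1) => ℝ) 0).symm (a, y))
        = (Set.Icc 0 t).indicator (fun a => a ^ p 0 * (t - a) ^ (n + ∑ i : Fin n, p i.succ + m) *
          (((∏ i : Fin n, ((p i.succ)! : ℝ)) * m !) / ((n + ∑ i : Fin n, p i.succ + m)! : ℝ))) a := by
      intro a
      have e : ∀ y : Fin n → ℝ, (MeasurableEquiv.piFinSuccAbove (fun _ : Fin (n + 1) => ℝ) 0).symm (a, y)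
          = Fin.cons a y := by
        intro y
        rw [← Fin.insertNth_zero']; rfl
      simp only [e]
      by_cases ha : a ∈ Set.Icc 0 t
      · rw [Set.indicator_of_mem ha]
        have h1 : ∀ y : Fin n → ℝ, (simpT (Fin (n+1)) t).indicator f (Fin.cons a y : Fin (n+1) → ℝ)
            = (simpT (Fin n) (t - a)).indicator (fun y => a ^ p 0 *
              ((∏ i, y i ^ p i.succ) * ((t - a) - ∑ i, y i) ^ m)) y := by
          intro y
          have hiff : (Fin.cons a y : Fin (n+1) → ℝ) ∈ simpT (Fin (n+1)) t ↔ y ∈ simpT (Fin n) (t - a) := by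
            simp only [simpT, Set.mem_ofPred_eq, Fin.forall_fin_succ, Fin.sum_univ_succ, Fin.cons_zero,
              Fin.cons_succ, ha.1, true_and]
            rw [le_sub_iff_add_le']
          by_cases hy : y ∈ simpT (Fin n) (t - a)
          · rw [Set.indicator_of_mem hy, Set.indicator_of_mem (hiff.2 hy)]
            simp only [hf, Fin.prod_univ_succ, Fin.sum_univ_succ, Fin.cons_zero, Fin.cons_succ]
            ring
          · rw [Set.indicator_of_notMem hy, Set.indicator_of_notMem (fun h => hy (hiff.1 h))]
        simp only [h1]
        rw [integral_indicator (simpT_compact _ _).measurableSet, integral_const_mul,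
          ih (t - a) (by linarith [ha.2])]
        ring
      · rw [Set.indicator_of_notMem ha]
        have h1 : ∀ y : Fin n → ℝ, (simpT (Fin (n+1)) t).indicator f (Fin.cons a y : Fin (n+1) → ℝ) = 0 := by
          intro y
          apply Set.indicator_of_notMem
          rintro ⟨h1, h2⟩
          apply ha
          have := Finset.single_le_sum (fun i _ => h1 i) (Finset.mem_univ 0)
          have h0 := h1 0
          simp only [Fin.cons_zero] at this h0
          exact ⟨h0, this.trans h2⟩
        simp [h1]
    simp only [key]
    rw [integral_indicator measurableSet_Icc, integral_Icc_eq_integral_Ioc,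
      ← intervalIntegral.integral_of_le ht, intervalIntegral.integral_mul_const, beta_nat]
    simp only [Fin.prod_univ_succ, Fin.sum_univ_succ]
    have e : p 0 + (n + ∑ i : Fin n, p i.succ + m) + 1 = n + 1 + (p 0 + ∑ i : Fin n, p i.succ) + m := by ring
    rw [e]
    have : ((n + ∑ i : Fin n, p i.succ + m)! : ℝ) ≠ 0 := by positivity
    field_simp

lemma dirichlet_ι {ι : Type*} [Fintype ι] (p : ι → ℕ) (m : ℕ) :
    ∫ x in simpT ι 1, (∏ i, x i ^ p i) * (1 - ∑ i, x i) ^ m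
      = ((∏ i, ((p i)! : ℝ)) * m !) / ((Fintype.card ι + ∑ i, p i + m)! : ℝ) := by
  have e := Fintype.equivFin ι
  have mp := volume_measurePreserving_piCongrLeft (fun _ : ι => ℝ) e.symm
  rw [← mp.setIntegral_preimage_emb (MeasurableEquiv.measurableEmbedding _)]
  have hx : ∀ (x : Fin (Fintype.card ι) → ℝ) i, MeasurableEquiv.piCongrLeft (fun _ : ι => ℝ) e.symm x i = x (e i) := by
    intro x i
    obtain ⟨j, rfl⟩ := e.symm.surjective i
    rw [MeasurableEquiv.piCongrLeft_apply_apply]; simp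
  have hset : (MeasurableEquiv.piCongrLeft (fun _ : ι => ℝ) e.symm) ⁻¹' (simpT ι 1) = simpT _ 1 := by
    ext x
    simp only [simpT, Set.mem_preimage, Set.mem_ofPred_eq, hx]
    rw [Equiv.sum_comp e x, e.forall_congr_left]
    simp
  rw [hset]
  simp only [hx]
  have h := dirichlet_fin (Fintype.card ι) 1 zero_le_one (fun i => p (e.symm i)) m
  rw [Equiv.sum_comp e.symm p, Equiv.prod_comp e.symm (fun i => ((p i)! : ℝ))] at h
  simp only [one_pow, one_mul] at h
  rw [← h]
  congr 1
  ext x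
  rw [Equiv.sum_comp e x, ← Equiv.prod_comp e (fun i => x i ^ p (e.symm i))]
  simp

lemma card_ne_one (k : ℕ) : Fintype.card {π : Equiv.Perm (Fin k) // π ≠ 1} + 1 = k ! := by
  have h : Fintype.card (Equiv.Perm (Fin k)) = k ! := by simp [Fintype.card_perm]
  rw [← h, Fintype.card_subtype_compl, Fintype.card_subtype_eq]
  have : 0 < Fintype.card (Equiv.Perm (Fin k)) := Fintype.card_pos
  omega

lemma prod_split (k : ℕ) {M : Type*} [CommMonoid M] (g : Equiv.Perm (Fin k) → M) :
    ∏ π, g π = (∏ q : {π : Equiv.Perm (Fin k) // π ≠ 1}, g q) * g 1 := by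
  rw [← Fintype.prod_subtype_mul_prod_subtype (fun π : Equiv.Perm (Fin k) => π ≠ 1) g]
  congr 1
  rw [Fintype.prod_eq_single ⟨1, by simp⟩]
  rintro ⟨b, hb⟩ h
  exact absurd (Subtype.ext (not_not.1 hb)) h

lemma moment (k : ℕ) (P : Equiv.Perm (Fin k) → ℕ) :
    ∫ x in cornerSimplex k, ∏ π, coeff k x π ^ P π
      = (∏ π, ((P π)! : ℝ)) / (((k !) - 1 + ∑ π, P π)! : ℝ) := by
  have h := dirichlet_ι (fun q : {π : Equiv.Perm (Fin k) // π ≠ 1} => P q) (P 1)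
  have hc := card_ne_one k
  have h3 : ∑ π, P π = (∑ q : {π : Equiv.Perm (Fin k) // π ≠ 1}, P q) + P 1 := by
    exact prod_split k (M := Multiplicative ℕ) P
  rw [prod_split, h3, ← add_assoc, show (k !) - 1 = Fintype.card {π : Equiv.Perm (Fin k) // π ≠ 1} by omega, ← h]
  show ∫ x in cornerSimplex k, _ = ∫ x in cornerSimplex k, _
  congr 1
  ext x
  rw [prod_split]
  congr 1
  · apply Finset.prod_congr rfl
    intro q _
    simp [coeff, q.2]
  · simp [coeff]

lemma vol_corner (k : ℕ) : (volume (cornerSimplex k)).toReal = 1 / (((k !) - 1)! : ℝ) := by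
  have h := moment k 0
  simpa [Measure.real] using h

lemma int_uniform (k : ℕ) (f : ({π : Equiv.Perm (Fin k) // π ≠ 1} → ℝ) → ℝ) :
    ∫ x, f x ∂(simplexUniform k) = (((k !) - 1)! : ℝ) * ∫ x in cornerSimplex k, f x := by
  rw [simplexUniform, integral_smul_measure, ENNReal.toReal_inv, vol_corner]
  simp

lemma coeff_cont (k : ℕ) (π : Equiv.Perm (Fin k)) : Continuous fun x => coeff k x π := by
  unfold coeff
  by_cases h : π = 1
  · simp only [h, dite_true]; fun_prop
  · simp only [h, dite_false]; fun_prop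

lemma int_of_cont (k : ℕ) {f : ({π : Equiv.Perm (Fin k) // π ≠ 1} → ℝ) → ℝ} (hf : Continuous f) :
    Integrable f (volume.restrict (cornerSimplex k)) :=
  hf.continuousOn.integrableOn_compact (simpT_compact {π : Equiv.Perm (Fin k) // π ≠ 1} 1)

lemma mean_coeff (k : ℕ) (a : Equiv.Perm (Fin k)) :
    ∫ x, coeff k x a ∂(simplexUniform k) = 1 / (k ! : ℝ) := by
  have h := moment k (Pi.single a 1)
  have h1 : ∀ x, ∏ π, coeff k x π ^ (Pi.single a 1 : Equiv.Perm (Fin k) → ℕ) π = coeff k x a := by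
    intro x
    rw [Fintype.prod_eq_single a]
    · simp
    · intro b hb; simp [hb]
  have h2 : ∏ π, (((Pi.single a 1 : Equiv.Perm (Fin k) → ℕ) π)! : ℝ) = 1 := by
    apply Finset.prod_eq_one
    intro b _
    by_cases hb : b = a
    · subst hb; simp
    · simp [hb]
  simp only [h1, h2] at h
  rw [int_uniform, h, Fintype.sum_pi_single']
  obtain ⟨n, hn⟩ : ∃ n, k ! = n + 1 := ⟨(k !) - 1, by have := Nat.factorial_pos k; omega⟩
  rw [hn, Nat.add_sub_cancel, Nat.factorial_succ]
  have : (n ! : ℝ) ≠ 0 := by positivity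
  push_cast
  field_simp

lemma second_coeff (k : ℕ) (a b : Equiv.Perm (Fin k)) :
    ∫ x, coeff k x a * coeff k x b ∂(simplexUniform k)
      = (1 + if a = b then 1 else 0) / ((k ! : ℝ) * (k ! + 1)) := by
  have h := moment k (Pi.single a 1 + Pi.single b 1)
  have h0 : ∀ x c, ∏ π, coeff k x π ^ (Pi.single c 1 : Equiv.Perm (Fin k) → ℕ) π = coeff k x c := by
    intro x c
    rw [Fintype.prod_eq_single c]
    · simp
    · intro b hb; simp [hb]
  have h1 : ∀ x, ∏ π, coeff k x π ^ (Pi.single a 1 + Pi.single b 1 : Equiv.Perm (Fin k) → ℕ) π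
      = coeff k x a * coeff k x b := by
    intro x
    simp only [Pi.add_apply, pow_add, Finset.prod_mul_distrib, h0]
  have h2 : ∏ π, (((Pi.single a 1 + Pi.single b 1 : Equiv.Perm (Fin k) → ℕ) π)! : ℝ)
      = 1 + if a = b then 1 else 0 := by
    by_cases hab : a = b
    · subst hab
      rw [Fintype.prod_eq_single a]
      · simp; norm_num
      · intro b hb; simp [hb]
    · simp only [hab, if_false, add_zero]
      apply Finset.prod_eq_one
      intro c _
      by_cases hc : c = a
      · subst hc; simp [hab]
      · by_cases hb : c = b
        · subst hb; simp [hc]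
        · simp [hb, hc]
  simp only [h1, h2] at h
  rw [int_uniform, h]
  simp only [Pi.add_apply, Finset.sum_add_distrib, Fintype.sum_pi_single']
  obtain ⟨n, hn⟩ : ∃ n, k ! = n + 1 := ⟨(k !) - 1, by have := Nat.factorial_pos k; omega⟩
  rw [hn, Nat.add_sub_cancel, ← add_assoc, Nat.factorial_succ, Nat.factorial_succ]
  have : (n ! : ℝ) ≠ 0 := by positivity
  push_cast
  field_simp
  try ring

lemma int_uniform_of_cont (k : ℕ) {f : ({π : Equiv.Perm (Fin k) // π ≠ 1} → ℝ) → ℝ} (hf : Continuous f) :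
    Integrable f (simplexUniform k) := by
  apply (int_of_cont k hf).smul_measure
  intro h
  rw [ENNReal.inv_eq_top] at h
  have h2 := vol_corner k
  rw [h] at h2
  have : (0:ℝ) < 1 / (((k !) - 1)! : ℝ) := by positivity
  simp at h2
  exact absurd h2.symm (by positivity)

lemma mean_lin (k : ℕ) (c : Equiv.Perm (Fin k) → ℝ) :
    ∫ x, (∑ π, coeff k x π * c π) ∂(simplexUniform k) = (∑ π, c π) / (k ! : ℝ) := by
  rw [integral_finsetSum]
  · simp only [integral_mul_const, mean_coeff]
    rw [← Finset.mul_sum]; ring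
  · intro π _
    exact int_uniform_of_cont k ((coeff_cont k π).mul continuous_const)

lemma second_lin (k : ℕ) (c : Equiv.Perm (Fin k) → ℝ) :
    ∫ x, (∑ π, coeff k x π * c π) ^ 2 ∂(simplexUniform k)
      = ((∑ π, c π) ^ 2 + ∑ π, c π ^ 2) / ((k ! : ℝ) * (k ! + 1)) := by
  have h : ∀ x, (∑ π, coeff k x π * c π) ^ 2
      = ∑ a, ∑ b, (coeff k x a * coeff k x b) * (c a * c b) := by
    intro x
    rw [sq, Finset.sum_mul_sum]
    refine Finset.sum_congr rfl fun a _ => Finset.sum_congr rfl fun b _ => by ring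
  have hi : ∀ a b, Integrable (fun x => (coeff k x a * coeff k x b) * (c a * c b)) (simplexUniform k) :=
    fun a b => int_uniform_of_cont k (((coeff_cont k a).mul (coeff_cont k b)).mul continuous_const)
  simp only [h]
  rw [integral_finsetSum _ (fun a _ => integrable_finsetSum _ fun b _ => hi a b)]
  have h2 : ∀ a, ∫ x, ∑ b, (coeff k x a * coeff k x b) * (c a * c b) ∂(simplexUniform k)
      = (c a * ∑ b, c b + c a ^ 2) / ((k ! : ℝ) * (k ! + 1)) := by
    intro a
    rw [integral_finsetSum _ (fun b _ => hi a b)]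
    simp only [integral_mul_const, second_coeff, div_mul_eq_mul_div, ← Finset.sum_div, add_mul, one_mul,
      ite_mul, zero_mul, Finset.sum_add_distrib, Finset.sum_ite_eq, Finset.mem_univ, if_true, Finset.mul_sum]
    rw [sq]
  simp only [h2]
  rw [← Finset.sum_div, Finset.sum_add_distrib, ← Finset.sum_mul, sq]

lemma Nperm_eq (k : ℕ) (π : Equiv.Perm (Fin k)) (i j : ℕ) :
    (Nperm k π i j : ℝ) = ∑ m : Fin k, (if (m:ℕ) < i then (1:ℝ) else 0) * (if (π m : ℕ) < j then 1 else 0) := by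
  rw [Nperm, Finset.card_filter]
  push_cast
  refine Finset.sum_congr rfl fun m _ => ?_
  by_cases h1 : (m:ℕ) < i <;> by_cases h2 : (π m : ℕ) < j <;> simp [h1, h2]

lemma sum_ind (k i : ℕ) (hi : i ≤ k) : ∑ m : Fin k, (if (m:ℕ) < i then (1:ℝ) else 0) = i := by
  rw [Fin.sum_univ_eq_sum_range (fun m => if m < i then (1:ℝ) else 0) k, ← Finset.sum_filter]
  have : (Finset.range k).filter (· < i) = Finset.range i := by
    ext; simp; omega
  rw [this]; simp

lemma one_pt (k : ℕ) (w : Fin k → ℝ) (m : Fin k) :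
    (k:ℝ) * ∑ π : Equiv.Perm (Fin k), w (π m) = k ! * ∑ l, w l := by
  have h : ∀ m', ∑ π : Equiv.Perm (Fin k), w (π m') = ∑ π : Equiv.Perm (Fin k), w (π m) := by
    intro m'
    rw [← Equiv.sum_comp (Equiv.mulRight (Equiv.swap m m'))]
    simp
  have h2 : ∑ m', ∑ π : Equiv.Perm (Fin k), w (π m') = k ! * ∑ l, w l := by
    rw [Finset.sum_comm]
    simp only [fun π : Equiv.Perm (Fin k) => Equiv.sum_comp π w]
    simp [Fintype.card_perm]
  simp only [h] at h2
  simpa using h2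

lemma two_pt (k : ℕ) (w : Fin k → ℝ) (m n : Fin k) (hmn : m ≠ n) :
    (k:ℝ) * (k - 1) * ∑ π : Equiv.Perm (Fin k), w (π m) * w (π n)
      = k ! * ((∑ l, w l) ^ 2 - ∑ l, w l ^ 2) := by
  set B := ∑ π : Equiv.Perm (Fin k), w (π m) * w (π n) with hB
  have h : ∀ m' n', m' ≠ n' → ∑ π : Equiv.Perm (Fin k), w (π m') * w (π n') = B := by
    intro m' n' h'
    obtain ⟨σ, h1, h2⟩ : ∃ σ : Equiv.Perm (Fin k), σ m' = m ∧ σ n' = n := by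
      refine ⟨Equiv.swap (Equiv.swap m' m n') n * Equiv.swap m' m, ?_, ?_⟩
      · simp only [Equiv.Perm.mul_apply, Equiv.swap_apply_left]
        apply Equiv.swap_apply_of_ne_of_ne _ hmn
        intro hh
        apply h'
        apply (Equiv.swap m' m).injective
        rw [Equiv.swap_apply_left]; exact hh
      · simp
    rw [hB, ← Equiv.sum_comp (Equiv.mulRight σ)]
    simp [h1, h2]
  have h2 : ∀ π : Equiv.Perm (Fin k), ∑ a, ∑ b, w (π a) * w (π b) = (∑ l, w l) ^ 2 := by
    intro π
    rw [← Finset.sum_mul_sum, Equiv.sum_comp π w, sq]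
  have h3 : ∑ a, ∑ b, ∑ π : Equiv.Perm (Fin k), w (π a) * w (π b) = k ! * (∑ l, w l) ^ 2 := by
    have : ∀ a, ∑ b, ∑ π : Equiv.Perm (Fin k), w (π a) * w (π b)
        = ∑ π : Equiv.Perm (Fin k), ∑ b, w (π a) * w (π b) := fun a => Finset.sum_comm
    simp only [this]
    rw [Finset.sum_comm]
    simp only [h2]
    simp [Fintype.card_perm]
  have h4 : ∀ a : Fin k, ∑ b, ∑ π : Equiv.Perm (Fin k), w (π a) * w (π b)
      = (∑ π : Equiv.Perm (Fin k), w (π a) ^ 2) + (k - 1) * B := by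
    intro a
    rw [← Finset.add_sum_erase _ _ (Finset.mem_univ a),
      Finset.sum_congr rfl (fun b hb => h a b (Finset.ne_of_mem_erase hb).symm)]
    have : 1 ≤ k := a.pos
    simp [Finset.card_erase_of_mem, Nat.cast_sub this, sq]
  simp only [h4] at h3
  have h5 : ∑ a, ∑ π : Equiv.Perm (Fin k), w (π a) ^ 2 = k ! * ∑ l, w l ^ 2 := by
    rw [Finset.sum_comm]
    simp only [fun π : Equiv.Perm (Fin k) => Equiv.sum_comp π (fun l => w l ^ 2)]
    simp [Fintype.card_perm]
  rw [Finset.sum_add_distrib, h5] at h3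
  simp at h3
  linarith

lemma sum_N (k i j : ℕ) (hi : i ≤ k) (hj : j ≤ k) (hk : 2 ≤ k) :
    ∑ π, (Nperm k π i j : ℝ) = k ! * (i * j) / k := by
  have hk0 : (k:ℝ) ≠ 0 := by positivity
  simp only [Nperm_eq]
  rw [Finset.sum_comm]
  simp only [← Finset.mul_sum]
  have h : ∀ m : Fin k, ∑ π : Equiv.Perm (Fin k), (if (π m : ℕ) < j then (1:ℝ) else 0) = k ! * j / k := by
    intro m
    have := one_pt k (fun l => if (l:ℕ) < j then (1:ℝ) else 0) m
    rw [sum_ind k j hj] at this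
    field_simp
    linarith
  simp only [h]
  rw [← Finset.sum_mul, sum_ind k i hi]
  ring

lemma sum_N_sq (k i j : ℕ) (hi : i ≤ k) (hj : j ≤ k) (hk : 2 ≤ k) :
    ∑ π, (Nperm k π i j : ℝ) ^ 2
      = k ! * (i * j) / k + k ! * (i * (i - 1) * (j * (j - 1))) / (k * (k - 1)) := by
  have hk0 : (k:ℝ) ≠ 0 := by positivity
  have hk1 : (k:ℝ) - 1 ≠ 0 := by
    have : (2:ℝ) ≤ k := by exact_mod_cast hk
    intro h; linarith
  set e : Fin k → ℝ := fun m => if (m:ℕ) < i then (1:ℝ) else 0 with he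
  set w : Fin k → ℝ := fun m => if (m:ℕ) < j then (1:ℝ) else 0 with hw
  have hee : ∀ m, e m * e m = e m := by intro m; simp [he]
  have hww : ∀ m, w m * w m = w m := by intro m; simp [hw]
  have hse : ∑ m, e m = i := sum_ind k i hi
  have hsw : ∑ m, w m = j := sum_ind k j hj
  have h1 : ∀ π : Equiv.Perm (Fin k), (Nperm k π i j : ℝ) ^ 2
      = ∑ a, ∑ b, (e a * e b) * (w (π a) * w (π b)) := by
    intro π
    rw [Nperm_eq, sq, Finset.sum_mul_sum]
    refine Finset.sum_congr rfl fun a _ => Finset.sum_congr rfl fun b _ => by simp only [he, hw]; ring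
  have hb : ∀ a b, ∑ π : Equiv.Perm (Fin k), (e a * e b) * (w (π a) * w (π b))
      = e a * e b * (k ! * (j * (j - 1)) / (k * (k - 1)))
        + (if a = b then e a * e b * (k ! * j / k - k ! * (j * (j - 1)) / (k * (k - 1))) else 0) := by
    intro a b
    rw [← Finset.mul_sum]
    by_cases hab : a = b
    · subst hab
      have := one_pt k w a
      rw [hsw] at this
      simp only [hww, if_true]
      rw [show ∑ π : Equiv.Perm (Fin k), w (π a) = k ! * j / k by field_simp; linarith]
      ring
    · have := two_pt k w a b hab
      simp only [sq (w _), hww, hsw] at this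
      rw [show ∑ π : Equiv.Perm (Fin k), w (π a) * w (π b) = k ! * (j * (j - 1)) / (k * (k - 1)) by
        field_simp; linarith]
      simp [hab]
  simp only [h1]
  rw [Finset.sum_comm]
  have hc : ∀ a : Fin k, ∑ π : Equiv.Perm (Fin k), ∑ b, (e a * e b) * (w (π a) * w (π b))
      = ∑ b, ∑ π : Equiv.Perm (Fin k), (e a * e b) * (w (π a) * w (π b)) := fun a => Finset.sum_comm
  simp only [hc, hb, Finset.sum_add_distrib, Finset.sum_ite_eq, Finset.mem_univ, if_true, hee,
    ← Finset.sum_mul, ← Finset.mul_sum, hse]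
  field_simp
  ring

/-- For `u = i/k`, `v = j/k` and coefficients `(α_π)` uniform on the simplex
`σ^{k!−1}`, `Y_k(u,v) = ∑_π α_π C_π(u,v)` satisfies `E[Y_k(u,v)] = uv` and
`V[Y_k(u,v)] = uv(1−u)(1−v)/((k!+1)(k−1)) = V[X_k(u,v)]/(k!+1)`. -/
theorem stmt_18 (k i j : ℕ) (hk : 2 ≤ k) (hi : i ≤ k) (hj : j ≤ k)
    (u v : ℝ) (hu : u = (i : ℝ) / k) (hv : v = (j : ℝ) / k) :
    (∫ x, (∑ π : Equiv.Perm (Fin k), coeff k x π * ((Nperm k π i j : ℝ) / k))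
        ∂(simplexUniform k)) = u * v ∧
      (∫ x, (∑ π : Equiv.Perm (Fin k), coeff k x π * ((Nperm k π i j : ℝ) / k)) ^ 2
          ∂(simplexUniform k)) -
        (∫ x, (∑ π : Equiv.Perm (Fin k), coeff k x π * ((Nperm k π i j : ℝ) / k))
          ∂(simplexUniform k)) ^ 2 =
      u * v * (1 - u) * (1 - v) / (((k ! : ℝ) + 1) * ((k : ℝ) - 1)) := by
  have hk2 : (2:ℝ) ≤ k := by exact_mod_cast hk
  have hk0 : (k:ℝ) ≠ 0 := by positivity
  have hk1 : (k:ℝ) - 1 ≠ 0 := by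
    intro h; linarith
  have hf : (k ! : ℝ) ≠ 0 := by positivity
  have hf1 : (k ! : ℝ) + 1 ≠ 0 := by positivity
  have hm : (∫ x, (∑ π : Equiv.Perm (Fin k), coeff k x π * ((Nperm k π i j : ℝ) / k))
        ∂(simplexUniform k)) = u * v := by
    rw [mean_lin, ← Finset.sum_div, sum_N k i j hi hj hk, hu, hv]
    field_simp
  refine ⟨hm, ?_⟩
  rw [hm, second_lin]
  simp only [div_pow, ← Finset.sum_div]
  rw [sum_N k i j hi hj hk, sum_N_sq k i j hi hj hk, hu, hv]
  field_simp
  ring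
end

section
/- Let k ≥ 2 be an integer and let (u,v) ∈ [0,1]², written as u = (i+t)/k and v = (j+s)/k with i = ⌊uk⌋, j = ⌊vk⌋, t = uk−i ∈ [0,1), s = vk−j ∈ [0,1). Let the coefficient vector α = (α_π), indexed by the k! permutations π of {1,…,k}, be chosen uniformly at random with respect to Lebesgue measure from the standard simplex σ^{k!−1} = {α : α_π ≥ 0 for all π, Σ_π α_π = 1}, and set Ŷ_k(u,v) = Σ_π α_π·Ĉ_π(u,v). Then the expected value of Ŷ_k(u,v) equals uv, and the variance of Ŷ_k(u,v) equals (1/((k!+1)(k−1)))·(u(1−u) − t(1−t)/k)·(v(1−v) − s(1−s)/k). -/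
open Nat Finset MeasureTheory

/-- The bilinear (checkerboard) extension `Ĉ_π(u,v)` of the permutation copula `C_π`,
where `u = (i+t)/k`, `v = (j+s)/k` with `i = ⌊uk⌋`, `j = ⌊vk⌋`, `t = uk−i`, `s = vk−j`. -/
noncomputable def Chat (k : ℕ) (π : Equiv.Perm (Fin k)) (i j : ℕ) (t s : ℝ) : ℝ :=
  (1 - t) * (1 - s) * ((Nperm k π i j : ℝ) / k) +
    t * (1 - s) * ((Nperm k π (i + 1) j : ℝ) / k) +
    (1 - t) * s * ((Nperm k π i (j + 1) : ℝ) / k) +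
    t * s * ((Nperm k π (i + 1) (j + 1) : ℝ) / k)

lemma gamma_int (n : ℕ) : ∫ r in Set.Ioi (0:ℝ), Real.exp (-r) * r ^ n = n ! := by
  rw [← Real.Gamma_nat_eq_factorial, Real.Gamma_eq_integral (by positivity)]
  refine setIntegral_congr_fun measurableSet_Ioi fun x _ => ?_
  simp

lemma gamma_intble (n : ℕ) : IntegrableOn (fun r : ℝ => Real.exp (-r) * r ^ n) (Set.Ioi 0) := by
  refine (Real.GammaIntegral_convergent (s := n + 1) (by positivity)).congr_fun (fun x _ => ?_) measurableSet_Ioi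
  simp

/-- The corner simplex of size `r`. -/
def cs (ι : Type*) [Fintype ι] (r : ℝ) : Set (ι → ℝ) := {x | (∀ q, 0 ≤ x q) ∧ ∑ q, x q ≤ r}

lemma cs_closed (ι : Type*) [Fintype ι] (r : ℝ) : IsClosed (cs ι r) := by
  have : cs ι r = (⋂ q, {x | 0 ≤ x q}) ∩ {x | ∑ q, x q ≤ r} := by ext; simp [cs]
  rw [this]
  refine (isClosed_iInter fun q => isClosed_le (by fun_prop) (by fun_prop)).inter
    (isClosed_le (by fun_prop) (by fun_prop))

lemma cs_compact (ι : Type*) [Fintype ι] (r : ℝ) : IsCompact (cs ι r) := by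
  refine (isCompact_univ_pi (fun _ : ι => isCompact_Icc (a := (0:ℝ)) (b := r))).of_isClosed_subset
    (cs_closed ι r) ?_
  intro x hx q _
  exact ⟨hx.1 q, (Finset.single_le_sum (fun i _ => hx.1 i) (Finset.mem_univ q)).trans hx.2⟩

lemma cs_scale {ι : Type*} [Fintype ι] (a : ι → ℕ) {r : ℝ} (hr : 0 < r) :
    ∫ x in cs ι r, ∏ i, x i ^ a i
      = r ^ (Fintype.card ι + ∑ i, a i) * ∫ x in cs ι 1, ∏ i, x i ^ a i := by
  have h := Measure.integral_comp_smul (volume : Measure (ι → ℝ))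
    ((cs ι r).indicator (fun x => ∏ i, x i ^ a i)) r
  rw [integral_indicator (cs_closed ι r).measurableSet] at h
  have h2 : ∀ x : ι → ℝ, (cs ι r).indicator (fun x => ∏ i, x i ^ a i) (r • x)
      = r ^ (∑ i, a i) * (cs ι 1).indicator (fun x => ∏ i, x i ^ a i) x := by
    intro x
    have hm : r • x ∈ cs ι r ↔ x ∈ cs ι 1 := by
      simp only [cs, Set.mem_ofPred_eq, Pi.smul_apply, smul_eq_mul, ← Finset.mul_sum]
      simp [hr, mul_le_iff_le_one_right]
    by_cases hx : x ∈ cs ι 1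
    · rw [Set.indicator_of_mem (hm.2 hx), Set.indicator_of_mem hx]
      simp [mul_pow, Finset.prod_mul_distrib, Finset.prod_pow_eq_pow_sum]
    · rw [Set.indicator_of_notMem (fun h => hx (hm.1 h)), Set.indicator_of_notMem hx]; simp
  simp_rw [h2] at h
  rw [integral_const_mul, integral_indicator (cs_closed ι 1).measurableSet] at h
  rw [Module.finrank_fintype_fun_eq_card, abs_of_pos (by positivity), smul_eq_mul] at h
  rw [pow_add, mul_assoc, h]
  field_simp

lemma dirichlet {ι : Type*} [Fintype ι] (a : ι → ℕ) :
    ∫ x in cs ι 1, ∏ i, x i ^ a i = (∏ i, ((a i)! : ℝ)) / (Fintype.card ι + ∑ i, a i)! := by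
  set g : (ι → ℝ) → ℝ := fun x => ∏ i, (Set.Ici (0:ℝ)).indicator (fun y => y ^ a i) (x i) with hg
  set F : (ι → ℝ) → ℝ → ℝ := fun x r => g x * (Set.Ici (∑ i, x i)).indicator (fun r => Real.exp (-r)) r with hF
  have hg0 : ∀ x, 0 ≤ g x := fun x => Finset.prod_nonneg fun i _ =>
    Set.indicator_nonneg (fun y (hy : 0 ≤ y) => by positivity) _
  have hgm : Measurable g := by
    refine Finset.measurable_prod _ fun i _ => ?_
    exact ((measurable_id.pow_const _).indicator measurableSet_Ici).comp (measurable_pi_apply i)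
  have hF0 : ∀ x r, 0 ≤ F x r := fun x r => mul_nonneg (hg0 x) (Set.indicator_nonneg (fun _ _ => (Real.exp_pos _).le) _)
  have hFm : Measurable (Function.uncurry F) := by
    refine (hgm.comp measurable_fst).mul ?_
    have : (fun p : (ι → ℝ) × ℝ => (Set.Ici (∑ i, p.1 i)).indicator (fun r => Real.exp (-r)) p.2)
      = {p : (ι → ℝ) × ℝ | ∑ i, p.1 i ≤ p.2}.indicator (fun p => Real.exp (-p.2)) := by
      ext p; simp [Set.indicator_apply]
    rw [this]
    exact (by fun_prop : Measurable fun p : (ι → ℝ) × ℝ => Real.exp (-p.2)).indicator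
      (measurableSet_le (by fun_prop) (by fun_prop))
  set h : ι → ℝ → ℝ := fun i => (Set.Ici (0:ℝ)).indicator (fun y => Real.exp (-y) * y ^ a i) with hh
  have hinner : ∀ x, ∫ r, F x r = ∏ i, h i (x i) := by
    intro x
    simp only [hF]
    rw [integral_const_mul, integral_indicator measurableSet_Ici, integral_Ici_eq_integral_Ioi,
      integral_exp_neg_Ioi, ← Finset.sum_neg_distrib, Real.exp_sum, hg, ← Finset.prod_mul_distrib]
    refine Finset.prod_congr rfl fun i _ => ?_
    simp only [hh, Set.indicator_apply]
    split_ifs <;> ring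
  have hhi : ∀ i, Integrable (h i) := by
    intro i
    rw [hh, integrable_indicator_iff measurableSet_Ici, integrableOn_Ici_iff_integrableOn_Ioi]
    exact gamma_intble _
  have hhv : ∀ i, ∫ y, h i y = (a i)! := by
    intro i
    rw [hh, integral_indicator measurableSet_Ici, integral_Ici_eq_integral_Ioi, gamma_int]
  have hFi : Integrable (Function.uncurry F) (volume.prod volume) := by
    rw [integrable_prod_iff hFm.aestronglyMeasurable]
    constructor
    · refine Filter.Eventually.of_forall fun x => ?_
      have h1 : Integrable ((Set.Ici (∑ i, x i)).indicator (fun r => Real.exp (-r))) := by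
        rw [integrable_indicator_iff measurableSet_Ici, integrableOn_Ici_iff_integrableOn_Ioi]
        exact integrableOn_exp_neg_Ioi _
      exact h1.const_mul (g x)
    · have : (fun x => ∫ r, ‖Function.uncurry F (x, r)‖) = fun x => ∏ i, h i (x i) := by
        ext x
        rw [← hinner x]
        refine integral_congr_ae (Filter.Eventually.of_forall fun r => ?_)
        exact Real.norm_of_nonneg (hF0 x r)
      rw [this]
      exact Integrable.fintype_prod (𝕜 := ℝ) hhi
  have hswap := integral_integral_swap hFi
  simp_rw [hinner] at hswap
  rw [integral_fintype_prod_volume_eq_prod] at hswap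
  simp_rw [hhv] at hswap
  have hout : ∀ r, ∫ x, F x r = Real.exp (-r) * ∫ x in cs ι r, ∏ i, x i ^ a i := by
    intro r
    rw [← integral_indicator (cs_closed ι r).measurableSet, ← integral_const_mul]
    congr 1
    ext x
    simp only [hF, hg, Set.indicator_apply, Set.mem_Ici]
    by_cases hx : ∀ i, 0 ≤ x i
    · by_cases hr : ∑ i, x i ≤ r
      · simp [hx, hr, cs, mul_comm]
      · simp [hr, cs]
    · have : x ∉ cs ι r := fun h => hx h.1
      rw [Set.indicator_of_notMem this]
      push Not at hx
      obtain ⟨i, hi⟩ := hx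
      rw [Finset.prod_eq_zero (Finset.mem_univ i) (by simp [hi])]
      simp
  simp_rw [hout] at hswap
  have hneg : ∀ r, r ∉ Set.Ici (0:ℝ) → Real.exp (-r) * ∫ x in cs ι r, ∏ i, x i ^ a i = 0 := by
    intro r hr
    have : cs ι r = ∅ := by
      ext x
      simp only [Set.mem_empty_iff_false, iff_false]
      intro hx
      exact hr ((Finset.sum_nonneg fun i _ => hx.1 i).trans hx.2)
    simp [this]
  rw [← setIntegral_eq_integral_of_forall_compl_eq_zero hneg, integral_Ici_eq_integral_Ioi,
    setIntegral_congr_fun measurableSet_Ioi (g := fun r => (Real.exp (-r) *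
      r ^ (Fintype.card ι + ∑ i, a i)) * ∫ x in cs ι 1, ∏ i, x i ^ a i)
      (fun r hr => by simp only []; rw [cs_scale a hr]; ring), integral_mul_const, gamma_int] at hswap
  rw [hswap]
  field_simp

lemma dir0 (ι : Type*) [Fintype ι] : (volume (cs ι 1)).toReal = 1 / (Fintype.card ι)! := by
  have := dirichlet (fun _ : ι => 0)
  simpa [Measure.real] using this

lemma dir1 {ι : Type*} [Fintype ι] (p : ι) : ∫ x in cs ι 1, x p = 1 / (Fintype.card ι + 1)! := by
  classical
  have := dirichlet (fun i : ι => if i = p then 1 else 0)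
  simp only [pow_ite, pow_one, pow_zero, Finset.prod_ite_eq', Finset.sum_ite_eq', Finset.mem_univ, if_true] at this
  rw [this, Finset.prod_eq_one]
  intro i _; split_ifs <;> simp

lemma dir2 {ι : Type*} [Fintype ι] [DecidableEq ι] (p q : ι) : ∫ x in cs ι 1, x p * x q
    = (if p = q then 2 else 1) / (Fintype.card ι + 2)! := by
  have := dirichlet (fun i : ι => (if i = p then 1 else 0) + (if i = q then 1 else 0))
  simp only [pow_add, pow_ite, pow_one, pow_zero, Finset.prod_mul_distrib, Finset.sum_add_distrib, Finset.prod_ite_eq', Finset.sum_ite_eq', Finset.mem_univ, if_true] at this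
  rw [this]
  congr 1
  by_cases h : p = q
  · subst h
    rw [if_pos rfl, Finset.prod_eq_single p] <;> simp
    intro b hb; simp [hb]
  · rw [if_neg h, Finset.prod_eq_one]
    intro i _
    by_cases h1 : i = p
    · subst h1; simp [h]
    · split_ifs <;> simp

lemma perm_moment1 {k : ℕ} (hk : 2 ≤ k) (a b : Fin k → ℝ) :
    ∑ π : Equiv.Perm (Fin k), ∑ m, a m * b (π m) = (k ! : ℝ) / k * ((∑ m, a m) * ∑ m, b m) := by
  have hk0 : (k:ℝ) ≠ 0 := by positivity
  set P : Fin k → ℝ := fun m => ∑ π : Equiv.Perm (Fin k), b (π m) with hP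
  have hinv : ∀ m n, P m = P n := by
    intro m n
    simp only [hP]
    exact Fintype.sum_equiv (Equiv.mulRight (Equiv.swap m n)) _ _ (fun π => by simp)
  have hsum : ∑ m, P m = k ! * ∑ m, b m := by
    simp only [hP]
    rw [Finset.sum_comm]
    simp_rw [fun π : Equiv.Perm (Fin k) => Equiv.sum_comp π b]
    simp [Fintype.card_perm]
  have hP1 : ∀ m, P m = (k ! : ℝ) / k * ∑ m, b m := by
    intro m
    rw [Finset.sum_congr rfl (fun n _ => hinv n m)] at hsum
    simp at hsum
    field_simp; linarith
  rw [Finset.sum_comm]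
  simp_rw [← Finset.mul_sum]
  change ∑ m, a m * P m = _
  simp_rw [hP1, ← Finset.sum_mul]; ring

lemma perm_moment2c {k : ℕ} (hk : 2 ≤ k) (a b : Fin k → ℝ) (ha : ∑ m, a m = 0)
    (hb : ∑ m, b m = 0) :
    ∑ π : Equiv.Perm (Fin k), (∑ m, a m * b (π m)) ^ 2
      = (k ! : ℝ) / (k - 1) * ((∑ m, a m ^ 2) * ∑ m, b m ^ 2) := by
  have hk2 : (2:ℝ) ≤ k := by exact_mod_cast hk
  have hk0 : (k:ℝ) ≠ 0 := by positivity
  have hk1 : (k:ℝ) - 1 ≠ 0 := by linarith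
  set P : Fin k → Fin k → ℝ := fun m n => ∑ π : Equiv.Perm (Fin k), b (π m) * b (π n) with hP
  have hinv : ∀ (τ : Equiv.Perm (Fin k)) m n, P m n = P (τ m) (τ n) := by
    intro τ m n
    simp only [hP]
    exact Fintype.sum_equiv (Equiv.mulRight τ⁻¹) _ _ (fun π => by simp)
  have hsum : ∑ m, P m m = k ! * ∑ m, b m ^ 2 := by
    simp only [hP]
    rw [Finset.sum_comm]
    simp_rw [fun π : Equiv.Perm (Fin k) => Equiv.sum_comp π (fun m => b m * b m)]
    simp [Fintype.card_perm, pow_two]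
  have hP1 : ∀ m, P m m = (k ! : ℝ) / k * ∑ m, b m ^ 2 := by
    intro m
    rw [Finset.sum_congr rfl (fun n _ => (by simpa using hinv (Equiv.swap n m) n n : P n n = P m m))] at hsum
    simp at hsum
    field_simp; linarith
  have hrow : ∀ m, ∑ n, P m n = 0 := by
    intro m
    simp only [hP]
    rw [Finset.sum_comm]
    simp_rw [← Finset.mul_sum, fun π : Equiv.Perm (Fin k) => Equiv.sum_comp π b, hb]
    simp
  have hP2 : ∀ m n, m ≠ n → P m n = - P m m / (k - 1) := by
    intro m n hmn
    have h := hrow m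
    rw [← Finset.add_sum_erase _ _ (Finset.mem_univ m)] at h
    rw [Finset.sum_congr rfl (fun n' hn' => (by
      have h1 : m ≠ n' := (Finset.ne_of_mem_erase hn').symm
      have := hinv (Equiv.swap n' n) m n'
      rwa [Equiv.swap_apply_left, Equiv.swap_apply_of_ne_of_ne h1 hmn] at this
       : P m n' = P m n))] at h
    simp at h
    rw [Nat.cast_sub (by omega)] at h
    push_cast at h
    field_simp; linarith
  have hP3 : ∀ m n, P m n = (k ! : ℝ) / k * (∑ m, b m ^ 2) / (k-1) * ((if m = n then (k:ℝ) else 0) - 1) := by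
    intro m n
    split_ifs with h
    · subst h; rw [hP1]; field_simp
    · rw [hP2 m n h, hP1]; ring
  have : ∀ π : Equiv.Perm (Fin k), (∑ m, a m * b (π m)) ^ 2
     = ∑ m, ∑ n, a m * a n * (b (π m) * b (π n)) := by
    intro π
    rw [pow_two, Finset.sum_mul_sum]
    refine Finset.sum_congr rfl fun m _ => Finset.sum_congr rfl fun n _ => by ring
  simp_rw [this]
  rw [Finset.sum_comm]
  simp_rw [Finset.sum_comm (s := (univ : Finset (Equiv.Perm (Fin k)))), ← Finset.mul_sum]
  change ∑ m, ∑ n, a m * a n * P m n = _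
  simp_rw [hP3]
  set c := (k ! : ℝ) / k * (∑ m, b m ^ 2) / (k-1)
  have h4 : ∀ m, ∑ n, a m * a n * (c * ((if m = n then (k:ℝ) else 0) - 1)) = c * k * a m ^ 2 := by
    intro m
    have : ∀ n, a m * a n * (c * ((if m = n then (k:ℝ) else 0) - 1)) = (if m = n then c * k * a m * a n else 0) - a m * c * a n := by
      intro n; split_ifs <;> ring
    simp_rw [this, Finset.sum_sub_distrib, ← Finset.mul_sum, ha]
    simp; ring
  simp_rw [h4, ← Finset.mul_sum]
  simp only [c]; field_simp

lemma sum_center {k : ℕ} (hk : 2 ≤ k) (a : Fin k → ℝ) :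
    ∑ m, (a m - (∑ m, a m) / k) = 0 := by
  have hk0 : (k:ℝ) ≠ 0 := by positivity
  simp [Finset.sum_sub_distrib]; field_simp; ring

lemma sum_center_sq {k : ℕ} (hk : 2 ≤ k) (a : Fin k → ℝ) :
    ∑ m, (a m - (∑ m, a m) / k) ^ 2 = ∑ m, a m ^ 2 - (∑ m, a m) ^ 2 / k := by
  have hk0 : (k:ℝ) ≠ 0 := by positivity
  set A := ∑ m, a m with hA
  have : ∀ m, (a m - A / k) ^ 2 = a m ^ 2 - (2 * A / k) * a m + (A / k) ^ 2 := by intro m; ring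
  simp_rw [this, Finset.sum_add_distrib, Finset.sum_sub_distrib, ← Finset.mul_sum, ← hA]
  simp; field_simp; ring

lemma perm_var {k : ℕ} (hk : 2 ≤ k) (a b : Fin k → ℝ) :
    ∑ π : Equiv.Perm (Fin k), (∑ m, a m * b (π m) - (∑ m, a m) * (∑ m, b m) / k) ^ 2
      = (k ! : ℝ) / (k - 1) * ((∑ m, a m ^ 2 - (∑ m, a m) ^ 2 / k) *
        (∑ m, b m ^ 2 - (∑ m, b m) ^ 2 / k)) := by
  have hk0 : (k:ℝ) ≠ 0 := by positivity
  rw [← sum_center_sq hk, ← sum_center_sq hk,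
    ← perm_moment2c hk _ _ (sum_center hk a) (sum_center hk b)]
  refine Finset.sum_congr rfl fun π _ => ?_
  congr 1
  have hb := Equiv.sum_comp π b
  set A := ∑ m, a m with hA
  set B := ∑ m, b m with hB
  have : ∀ m, (a m - A / k) * (b (π m) - B / k) = a m * b (π m) - (B / k) * a m - (A/k) * b (π m) + A/k * (B / k) := by
    intro m; ring
  simp_rw [this, Finset.sum_add_distrib, Finset.sum_sub_distrib, ← Finset.mul_sum, hb, ← hA]
  simp; field_simp; ring

lemma unif_int {ι : Type*} [Fintype ι] (f : (ι → ℝ) → ℝ) :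
    ∫ x, f x ∂((volume (cs ι 1))⁻¹ • volume.restrict (cs ι 1))
      = (Fintype.card ι)! * ∫ x in cs ι 1, f x := by
  rw [integral_smul_measure, ENNReal.toReal_inv, dir0]
  simp

lemma cs_intble {ι : Type*} [Fintype ι] {f : (ι → ℝ) → ℝ} (hf : Continuous f) :
    IntegrableOn f (cs ι 1) := hf.continuousOn.integrableOn_compact (cs_compact ι 1)

lemma unif_mean {ι : Type*} [Fintype ι] (c : ℝ) (d : ι → ℝ) :
    ∫ x, (c + ∑ q, d q * x q) ∂((volume (cs ι 1))⁻¹ • volume.restrict (cs ι 1))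
      = c + (∑ q, d q) / (Fintype.card ι + 1) := by
  rw [unif_int, integral_add (cs_intble (by fun_prop)) (cs_intble (by fun_prop)),
    integral_finsetSum _ (fun i _ => cs_intble (by fun_prop))]
  simp_rw [integral_const_mul, dir1, ← Finset.sum_mul]
  rw [setIntegral_const, Measure.real, dir0, Nat.factorial_succ]
  push_cast
  have : ((Fintype.card ι)! : ℝ) ≠ 0 := by positivity
  simp only [smul_eq_mul]
  field_simp

lemma unif_sq {ι : Type*} [Fintype ι] (c : ℝ) (d : ι → ℝ) :
    ∫ x, (c + ∑ q, d q * x q) ^ 2 ∂((volume (cs ι 1))⁻¹ • volume.restrict (cs ι 1))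
      = c ^ 2 + 2 * c * (∑ q, d q) / (Fintype.card ι + 1)
        + ((∑ q, d q) ^ 2 + ∑ q, d q ^ 2) / ((Fintype.card ι + 1) * (Fintype.card ι + 2)) := by
  classical
  have h : ∀ x : ι → ℝ, (c + ∑ q, d q * x q) ^ 2 = (c ^ 2 + ∑ q, (2 * c * d q) * x q)
      + ∑ p, ∑ q, (d p * d q) * (x p * x q) := by
    intro x
    have h1 : ∑ p, ∑ q, (d p * d q) * (x p * x q) = (∑ q, d q * x q) ^ 2 := by
      rw [pow_two, Finset.sum_mul_sum]
      refine Finset.sum_congr rfl fun m _ => Finset.sum_congr rfl fun n _ => by ring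
    rw [h1]
    simp_rw [mul_assoc, ← Finset.mul_sum]
    ring
  simp_rw [h]
  rw [unif_int, integral_add (cs_intble (by fun_prop)) (cs_intble (by fun_prop)), mul_add,
    ← unif_int, unif_mean, integral_finsetSum _ (fun i _ => cs_intble (by fun_prop))]
  simp_rw [fun i => integral_finsetSum (μ := volume.restrict (cs ι 1)) univ
    (f := fun (q : ι) (x : ι → ℝ) => (d i * d q) * (x i * x q)) (fun q _ => cs_intble (by fun_prop)),
    integral_const_mul, dir2]
  have h3 : ∀ p q, d p * d q * ((if p = q then (2:ℝ) else 1) / ((Fintype.card ι + 2)! : ℝ))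
    = (d p * d q + if p = q then d p * d q else 0) / ((Fintype.card ι + 2)! : ℝ) := by
    intro p q; split_ifs <;> ring
  simp_rw [h3, ← Finset.sum_div, Finset.sum_add_distrib, ← Finset.mul_sum, ← Finset.sum_mul]
  simp only [Finset.sum_ite_eq, Finset.mem_univ, if_true]
  rw [Nat.factorial_succ, Nat.factorial_succ]
  push_cast
  have : ((Fintype.card ι)! : ℝ) ≠ 0 := by positivity
  simp_rw [pow_two]
  field_simp
  ring

/-- Row weights. -/
noncomputable def wt (k i : ℕ) (t : ℝ) (m : Fin k) : ℝ :=
  (1 - t) * (if (m : ℕ) < i then 1 else 0) + t * (if (m : ℕ) < i + 1 then 1 else 0)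

lemma sum_lt {k i : ℕ} (h : i ≤ k) : ∑ m : Fin k, (if (m : ℕ) < i then (1:ℝ) else 0) = i := by
  rw [Fin.sum_univ_eq_sum_range (fun m => if m < i then (1:ℝ) else 0) k, Finset.sum_boole]
  congr 1
  rw [show (Finset.range k).filter (fun m => m < i) = Finset.range i by ext; simp; omega]
  simp

lemma wt_cases {k : ℕ} (hk : 2 ≤ k) {u : ℝ} (hu : u ∈ Set.Icc (0 : ℝ) 1) {i : ℕ} {t : ℝ}
    (hi : i = ⌊u * k⌋₊) (ht : t = u * k - i) : i ≤ k ∧ (t = 0 ∨ i + 1 ≤ k) := by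
  have h0 : 0 ≤ u * k := mul_nonneg hu.1 (by positivity)
  have h1 : u * k ≤ k := mul_le_of_le_one_left (by positivity) hu.2
  have h2 : (i:ℝ) ≤ u * k := hi ▸ Nat.floor_le h0
  have h3 : i ≤ k := by exact_mod_cast h2.trans h1
  refine ⟨h3, ?_⟩
  rcases h3.lt_or_eq with h | h
  · right; omega
  · left
    rw [h] at h2 ht
    linarith

lemma sum_wt {k : ℕ} (hk : 2 ≤ k) {u : ℝ} (hu : u ∈ Set.Icc (0 : ℝ) 1) {i : ℕ} {t : ℝ}
    (hi : i = ⌊u * k⌋₊) (ht : t = u * k - i) : ∑ m, wt k i t m = u * k := by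
  obtain ⟨h1, h2⟩ := wt_cases hk hu hi ht
  simp only [wt, Finset.sum_add_distrib, ← Finset.mul_sum]
  rw [sum_lt h1]
  rcases h2 with h2 | h2
  · rw [h2] at ht ⊢; linarith
  · rw [sum_lt h2]; push_cast; linarith

lemma sum_wt_sq {k : ℕ} (hk : 2 ≤ k) {u : ℝ} (hu : u ∈ Set.Icc (0 : ℝ) 1) {i : ℕ} {t : ℝ}
    (hi : i = ⌊u * k⌋₊) (ht : t = u * k - i) : ∑ m, wt k i t m ^ 2 = i + t ^ 2 := by
  obtain ⟨h1, h2⟩ := wt_cases hk hu hi ht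
  have h : ∀ m : Fin k, wt k i t m ^ 2 = (1 - t ^ 2) * (if (m : ℕ) < i then 1 else 0)
      + t ^ 2 * (if (m : ℕ) < i + 1 then 1 else 0) := by
    intro m
    unfold wt
    split_ifs
    · ring
    · omega
    · ring
    · ring
  simp only [h, Finset.sum_add_distrib, ← Finset.mul_sum]
  rw [sum_lt h1]
  rcases h2 with h2 | h2
  · rw [h2]; ring
  · rw [sum_lt h2]; push_cast; ring

lemma sum_wt_var {k : ℕ} (hk : 2 ≤ k) {u : ℝ} (hu : u ∈ Set.Icc (0 : ℝ) 1) {i : ℕ} {t : ℝ}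
    (hi : i = ⌊u * k⌋₊) (ht : t = u * k - i) :
    ∑ m, wt k i t m ^ 2 - (∑ m, wt k i t m) ^ 2 / k = k * (u * (1 - u) - t * (1 - t) / k) := by
  have hk0 : (k:ℝ) ≠ 0 := by positivity
  rw [sum_wt hk hu hi ht, sum_wt_sq hk hu hi ht]
  have : (i:ℝ) = u * k - t := by linarith
  rw [this]
  field_simp
  ring

lemma Chat_eq (k : ℕ) (π : Equiv.Perm (Fin k)) (i j : ℕ) (t s : ℝ) :
    Chat k π i j t s = (∑ m, wt k i t m * wt k j s (π m)) / k := by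
  have hN : ∀ i j, (Nperm k π i j : ℝ) = ∑ m : Fin k, (if (m : ℕ) < i then (1:ℝ) else 0) *
      (if (π m : ℕ) < j then (1:ℝ) else 0) := by
    intro i j
    simp only [Nperm, Finset.card_filter, Nat.cast_sum, Nat.cast_ite, Nat.cast_one, Nat.cast_zero]
    refine Finset.sum_congr rfl fun m _ => ?_
    by_cases h1 : (m : ℕ) < i <;> by_cases h2 : (π m : ℕ) < j <;> simp [h1, h2]
  simp only [Chat, hN, ← mul_div_assoc, ← add_div, Finset.mul_sum, ← Finset.sum_add_distrib]
  congr 1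
  refine Finset.sum_congr rfl fun m _ => ?_
  unfold wt
  ring

lemma coeff_sum (k : ℕ) (x : {π : Equiv.Perm (Fin k) // π ≠ 1} → ℝ)
    (c : Equiv.Perm (Fin k) → ℝ) :
    ∑ π, coeff k x π * c π = c 1 + ∑ q : {π : Equiv.Perm (Fin k) // π ≠ 1}, (c q - c 1) * x q := by
  have h := Fintype.sum_eq_add_sum_subtype_ne (fun π => coeff k x π * c π) 1
  rw [h]
  have h2 : ∀ q : {π : Equiv.Perm (Fin k) // π ≠ 1}, coeff k x q = x q := by
    intro q; simp [coeff, q.2]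
  simp only [h2]
  simp only [coeff, dif_pos, sub_mul, Finset.sum_sub_distrib, ← Finset.mul_sum]
  simp_rw [mul_comm (x _)]
  ring

/-- For `(u,v) ∈ [0,1]²` written as `u = (i+t)/k`, `v = (j+s)/k` with `i = ⌊uk⌋`,
`j = ⌊vk⌋`, `t = uk−i`, `s = vk−j`, and coefficients `(α_π)` uniform on the simplex
`σ^{k!−1}`, the random field `Ŷ_k(u,v) = ∑_π α_π Ĉ_π(u,v)` satisfies
`E[Ŷ_k(u,v)] = uv` and
`V[Ŷ_k(u,v)] = (1/((k!+1)(k−1)))·(u(1−u) − t(1−t)/k)·(v(1−v) − s(1−s)/k)`. -/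
theorem stmt_19 (k : ℕ) (hk : 2 ≤ k) (u v : ℝ)
    (hu : u ∈ Set.Icc (0 : ℝ) 1) (hv : v ∈ Set.Icc (0 : ℝ) 1)
    (i j : ℕ) (t s : ℝ)
    (hi : i = ⌊u * k⌋₊) (hj : j = ⌊v * k⌋₊)
    (ht : t = u * k - i) (hs : s = v * k - j) :
    (∫ x, (∑ π : Equiv.Perm (Fin k), coeff k x π * Chat k π i j t s)
        ∂(simplexUniform k)) = u * v ∧
      (∫ x, (∑ π : Equiv.Perm (Fin k), coeff k x π * Chat k π i j t s) ^ 2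
          ∂(simplexUniform k)) -
        (∫ x, (∑ π : Equiv.Perm (Fin k), coeff k x π * Chat k π i j t s)
          ∂(simplexUniform k)) ^ 2 =
      (1 / (((k ! : ℝ) + 1) * ((k : ℝ) - 1))) * (u * (1 - u) - t * (1 - t) / k) *
        (v * (1 - v) - s * (1 - s) / k) := by
  have hk0 : (k:ℝ) ≠ 0 := by positivity
  have hk2 : (2:ℝ) ≤ k := by exact_mod_cast hk
  have hk1 : (k:ℝ) - 1 ≠ 0 := by linarith
  have hf0 : (k ! : ℝ) ≠ 0 := by positivity
  set c : Equiv.Perm (Fin k) → ℝ := fun π => Chat k π i j t s with hc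
  have hcard : (Fintype.card {π : Equiv.Perm (Fin k) // π ≠ 1} : ℝ) = (k ! : ℝ) - 1 := by
    rw [Fintype.card_subtype_compl, Fintype.card_perm, Fintype.card_fin, Fintype.card_subtype_eq,
      Nat.cast_sub (Nat.factorial_pos k)]
    simp
  have hm := unif_mean (c 1) (fun q : {π : Equiv.Perm (Fin k) // π ≠ 1} => c q - c 1)
  have hq := unif_sq (c 1) (fun q : {π : Equiv.Perm (Fin k) // π ≠ 1} => c q - c 1)
  have hY : ∀ x, ∑ π, coeff k x π * Chat k π i j t s = _ := fun x => coeff_sum k x c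
  have hμ : simplexUniform k = (volume (cs {π : Equiv.Perm (Fin k) // π ≠ 1} 1))⁻¹ •
    volume.restrict (cs {π : Equiv.Perm (Fin k) // π ≠ 1} 1) := rfl
  simp_rw [hY, hμ]
  rw [hm, hq, hcard]
  have hD := Fintype.sum_eq_add_sum_subtype_ne (fun π => c π - c 1) 1
  have hQ := Fintype.sum_eq_add_sum_subtype_ne (fun π => (c π - c 1) ^ 2) 1
  simp only [sub_self, zero_add, ne_eq, OfNat.ofNat_ne_zero, not_false_eq_true, zero_pow] at hD hQ
  rw [← hD, ← hQ]
  have hsum : ∑ π, c π = k ! * (u * v) := by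
    have := perm_moment1 hk (wt k i t) (wt k j s)
    rw [sum_wt hk hu hi ht, sum_wt hk hv hj hs] at this
    simp only [hc, Chat_eq, ← Finset.sum_div, this]
    field_simp
  have hvar : ∑ π, (c π - u * v) ^ 2 = (k ! : ℝ) / (k - 1) * ((u * (1 - u) - t * (1 - t) / k) *
        (v * (1 - v) - s * (1 - s) / k)) := by
    have := perm_var hk (wt k i t) (wt k j s)
    rw [sum_wt_var hk hu hi ht, sum_wt_var hk hv hj hs, sum_wt hk hu hi ht, sum_wt hk hv hj hs] at this
    have h2 : ∀ π, (c π - u * v) ^ 2 = (∑ m, wt k i t m * wt k j s (π m) - u * k * (v * k) / k) ^ 2 / k ^ 2 := by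
      intro π
      simp only [hc, Chat_eq]
      field_simp
    simp_rw [h2, ← Finset.sum_div, this]
    field_simp
  have hD' : ∑ π, (c π - c 1) = k ! * (u * v - c 1) := by
    rw [Finset.sum_sub_distrib, hsum]
    simp [Fintype.card_perm]; ring
  have hQ' : ∑ π, (c π - c 1) ^ 2 = ∑ π, (c π - u * v) ^ 2 + k ! * (u * v - c 1) ^ 2 := by
    have : ∀ π, (c π - c 1) ^ 2 = (c π - u * v) ^ 2 + 2 * (u * v - c 1) * c π
        + ((u * v - c 1) ^ 2 - 2 * (u * v - c 1) * (u * v)) := by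
      intro π; ring
    simp_rw [this, Finset.sum_add_distrib, ← Finset.mul_sum, hsum]
    simp [Fintype.card_perm]; ring
  rw [hQ', hD', hvar]
  have e1 : (k ! : ℝ) - 1 + 1 = k ! := by ring
  have e2 : (k ! : ℝ) - 1 + 2 = k ! + 1 := by ring
  rw [e1, e2]
  have hf1 : (k ! : ℝ) + 1 ≠ 0 := by positivity
  generalize u * (1 - u) - t * (1 - t) / k = X
  generalize v * (1 - v) - s * (1 - s) / k = Z
  constructor
  · field_simp; ring
  · field_simp; ring
end
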